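/- arXiv:1102.5583 — 2 statements merged into one kernel-verified Lean document; each statement's English description precedes it below -/
import Mathlib

section
/- The mobile distance is nonnegative, definite and symmetric: for all v⁰, v¹ ∈ L², one has m_φ(v⁰, v¹) ≥ 0 with equality if and only if v⁰ = v¹, and m_φ(v⁰, v¹) = m_φ(v¹, v⁰). -/
open MeasureTheory Filter

noncomputable section

/-- Translation `(τ_q v)(x) = v(x - q)` acting on `L²(ℝ^d; ℝ)`. -/
def tau {d : ℕ} (q : EuclideanSpace ℝ (Fin d))
    (v : Lp ℝ 2 (volume : Measure (EuclideanSpace ℝ (Fin d)))) :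
    Lp ℝ 2 (volume : Measure (EuclideanSpace ℝ (Fin d))) :=
  Lp.compMeasurePreserving (fun x => x - q) (measurePreserving_sub_right volume q) v

/-- The squared mobile distance
`m_φ(v⁰, v¹)² = inf { ‖v^{1−j} − τ_q v^j‖₂² + |q|² φ(‖v^j‖₂)² : q ∈ ℝ^d, j ∈ {0,1} }`. -/
def mobSq {d : ℕ} (φ : ℝ → ℝ)
    (v0 v1 : Lp ℝ 2 (volume : Measure (EuclideanSpace ℝ (Fin d)))) : ℝ :=
  sInf {r : ℝ | ∃ q : EuclideanSpace ℝ (Fin d),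
      r = ‖v1 - tau q v0‖ ^ 2 + ‖q‖ ^ 2 * φ ‖v0‖ ^ 2 ∨
      r = ‖v0 - tau q v1‖ ^ 2 + ‖q‖ ^ 2 * φ ‖v1‖ ^ 2}

/-- The mobile distance `m_φ`. -/
def mob {d : ℕ} (φ : ℝ → ℝ)
    (v0 v1 : Lp ℝ 2 (volume : Measure (EuclideanSpace ℝ (Fin d)))) : ℝ :=
  Real.sqrt (mobSq φ v0 v1)

end

section TranslationLemmas

variable {d : ℕ}

lemma tau_zero_left (v : Lp ℝ 2 (volume : Measure (EuclideanSpace ℝ (Fin d)))) :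
    tau 0 v = v := by
  simp only [tau, sub_zero]
  exact Lp.compMeasurePreserving_id_apply v

lemma tau_zero_right (q : EuclideanSpace ℝ (Fin d)) :
    tau q (0 : Lp ℝ 2 (volume : Measure (EuclideanSpace ℝ (Fin d)))) = 0 :=
  map_zero _

/-- Translations act strongly continuously on `L²`. -/
lemma continuous_tau (v : Lp ℝ 2 (volume : Measure (EuclideanSpace ℝ (Fin d)))) :
    Continuous fun q => tau q v := by
  let g : EuclideanSpace ℝ (Fin d) →
      C(EuclideanSpace ℝ (Fin d), EuclideanSpace ℝ (Fin d)) :=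
    fun q => ⟨fun x => x - q, by fun_prop⟩
  have hg : Continuous g := ContinuousMap.continuous_of_continuous_uncurry _ (by
    change Continuous fun p : EuclideanSpace ℝ (Fin d) × EuclideanSpace ℝ (Fin d) => p.2 - p.1
    fun_prop)
  exact Continuous.compMeasurePreservingLp (f := fun _ => v) (g := g) continuous_const hg
    (fun q => measurePreserving_sub_right volume q) (by simp)

/-- The cost of moving `v` to `w ≠ v` is bounded away from zero. -/
lemma exists_pos_le_cost {v w : Lp ℝ 2 (volume : Measure (EuclideanSpace ℝ (Fin d)))}
    (hvw : v ≠ w) {a : ℝ} (ha : ‖v‖ ≤ a) :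
    ∃ c > 0, ∀ q, c ≤ ‖w - tau q v‖ ^ 2 + ‖q‖ ^ 2 * a ^ 2 := by
  have hD : 0 < ‖w - v‖ := norm_pos_iff.2 (sub_ne_zero.2 hvw.symm)
  rcases eq_or_ne v 0 with rfl | hv
  · refine ⟨‖w - 0‖ ^ 2, by positivity, fun q => ?_⟩
    rw [tau_zero_right]
    exact le_add_of_nonneg_right (by positivity)
  have ha0 : 0 < a := (norm_pos_iff.2 hv).trans_le ha
  obtain ⟨δ, hδ, h⟩ := Metric.continuous_iff.1 (continuous_tau v) 0 (‖w - v‖ / 2) (by positivity)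
  refine ⟨min ((‖w - v‖ / 2) ^ 2) (δ ^ 2 * a ^ 2), by positivity, fun q => ?_⟩
  rcases lt_or_ge ‖q‖ δ with hq | hq
  · have hclose := h q (by simpa using hq)
    rw [tau_zero_left, dist_eq_norm] at hclose
    have htri := norm_sub_le_norm_sub_add_norm_sub w (tau q v) v
    have hfar : ‖w - v‖ / 2 ≤ ‖w - tau q v‖ := by linarith
    calc _ ≤ (‖w - v‖ / 2) ^ 2 := min_le_left _ _
      _ ≤ ‖w - tau q v‖ ^ 2 := by gcongr
      _ ≤ _ := le_add_of_nonneg_right (by positivity)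
  · calc _ ≤ δ ^ 2 * a ^ 2 := min_le_right _ _
      _ ≤ ‖q‖ ^ 2 * a ^ 2 := by gcongr
      _ ≤ _ := le_add_of_nonneg_left (by positivity)

lemma mobSq_comm (φ : ℝ → ℝ)
    (v0 v1 : Lp ℝ 2 (volume : Measure (EuclideanSpace ℝ (Fin d)))) :
    mobSq φ v0 v1 = mobSq φ v1 v0 := by
  simp only [mobSq, or_comm]

lemma mobSq_self (φ : ℝ → ℝ) (v : Lp ℝ 2 (volume : Measure (EuclideanSpace ℝ (Fin d)))) :
    mobSq φ v v = 0 := by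
  refine IsLeast.csInf_eq ⟨⟨0, Or.inl (by simp [tau_zero_left])⟩, ?_⟩
  rintro r ⟨q, rfl | rfl⟩ <;> positivity

lemma mobSq_pos {φ : ℝ → ℝ} (hφ : ∀ a : ℝ, 0 ≤ a → a ≤ φ a)
    {v0 v1 : Lp ℝ 2 (volume : Measure (EuclideanSpace ℝ (Fin d)))} (hne : v0 ≠ v1) :
    0 < mobSq φ v0 v1 := by
  obtain ⟨c, hc, h⟩ := exists_pos_le_cost hne (hφ _ (norm_nonneg v0))
  obtain ⟨c', hc', h'⟩ := exists_pos_le_cost hne.symm (hφ _ (norm_nonneg v1))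
  refine (lt_min hc hc').trans_le (le_csInf ⟨_, 0, Or.inl rfl⟩ ?_)
  rintro r ⟨q, rfl | rfl⟩
  · exact (min_le_left _ _).trans (h q)
  · exact (min_le_right _ _).trans (h' q)

end TranslationLemmas


/-- **The mobile distance is nonnegative, definite and symmetric**: for all `v⁰, v¹ ∈ L²`,
`m_φ(v⁰, v¹) ≥ 0` with equality iff `v⁰ = v¹`, and `m_φ(v⁰, v¹) = m_φ(v¹, v⁰)`. -/
theorem mob_nonneg_definite_symm {d : ℕ} (hd : 0 < d) (φ : ℝ → ℝ)
    (hφc : ContinuousOn φ (Set.Ici 0)) (hφm : MonotoneOn φ (Set.Ici 0))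
    (hφ1 : ∀ a : ℝ, 0 ≤ a → a ≤ φ a)
    (hφ4 : ∀ a b : ℝ, 0 ≤ a → 0 ≤ b → b ≤ 2 * a → φ b ≤ 4 * φ a)
    (v0 v1 : Lp ℝ 2 (volume : Measure (EuclideanSpace ℝ (Fin d)))) :
    0 ≤ mob φ v0 v1 ∧ (mob φ v0 v1 = 0 ↔ v0 = v1) ∧ mob φ v0 v1 = mob φ v1 v0 := by
  refine ⟨Real.sqrt_nonneg _, ⟨fun h => ?_, ?_⟩, congrArg Real.sqrt (mobSq_comm φ v0 v1)⟩
  · by_contra hne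
    exact (Real.sqrt_pos.2 (mobSq_pos hφ1 hne)).ne' h
  · rintro rfl
    simp [mob, mobSq_self]
end

section
/- Completeness of the mobile distance: if a sequence (v^n) in L² satisfies m_φ(v^m, v^n) → 0 as m, n → ∞, then there exists v ∈ L² with ‖v^n − v‖₂ → 0 as n → ∞; in particular the sequence also converges to v in the mobile distance. -/
open MeasureTheory Filter

local notation "L2[" d "]" => Lp ℝ 2 (volume : Measure (EuclideanSpace ℝ (Fin d)))

section Translation

variable {d : ℕ}

lemma tau_zero (v : L2[d]) : tau 0 v = v := by
  have h : (fun x : EuclideanSpace ℝ (Fin d) => x - 0) = id := by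
    ext1 x
    simp
  unfold tau
  simp only [h]
  exact Lp.compMeasurePreserving_id_apply v

lemma tau_tau (p q : EuclideanSpace ℝ (Fin d)) (v : L2[d]) :
    tau p (tau q v) = tau (q + p) v := by
  have h : (fun x : EuclideanSpace ℝ (Fin d) => x - (q + p)) =
      (fun x => x - q) ∘ (fun x => x - p) := by
    ext1 x
    simp [sub_sub, add_comm]
  unfold tau
  simp only [h]
  exact (Lp.compMeasurePreserving_comp_apply v _ _).symm

lemma tau_sub (q : EuclideanSpace ℝ (Fin d)) (v w : L2[d]) :
    tau q (v - w) = tau q v - tau q w :=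
  map_sub _ v w

lemma norm_tau (q : EuclideanSpace ℝ (Fin d)) (v : L2[d]) : ‖tau q v‖ = ‖v‖ :=
  Lp.norm_compMeasurePreserving v _

lemma continuous_tau_s5 :
    Continuous fun z : EuclideanSpace ℝ (Fin d) × L2[d] => tau z.1 z.2 := by
  let g : EuclideanSpace ℝ (Fin d) × L2[d] →
      C(EuclideanSpace ℝ (Fin d), EuclideanSpace ℝ (Fin d)) :=
    fun z => ⟨fun x => x - z.1, by fun_prop⟩
  have hg : Continuous g := ContinuousMap.continuous_of_continuous_uncurry _ (by
    change Continuous fun y : (EuclideanSpace ℝ (Fin d) × L2[d]) × EuclideanSpace ℝ (Fin d) =>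
      y.2 - y.1.1
    fun_prop)
  exact Continuous.compMeasurePreservingLp (g := g) continuous_snd hg
    (fun z => measurePreserving_sub_right volume z.1) (by simp)

lemma norm_sub_tau_comm (q : EuclideanSpace ℝ (Fin d)) (v w : L2[d]) :
    ‖v - tau q w‖ = ‖w - tau (-q) v‖ := by
  rw [← norm_tau (-q) (v - tau q w), tau_sub, tau_tau, add_neg_cancel, tau_zero, norm_sub_rev]

end Translation

section MobileDistance

variable {d : ℕ} {φ : ℝ → ℝ}

lemma mob_le_norm_sub (v w : L2[d]) : mob φ v w ≤ ‖v - w‖ := by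
  refine Real.sqrt_le_iff.2 ⟨norm_nonneg _, csInf_le ⟨0, ?_⟩ ⟨0, Or.inr ?_⟩⟩
  · rintro r ⟨q, rfl | rfl⟩ <;> positivity
  · simp [tau_zero]

/-- Two functions at small mobile distance differ by a small translation and a small error. -/
lemma exists_norm_sub_tau_lt_of_mob_lt (hφ : ∀ a : ℝ, 0 ≤ a → a ≤ φ a) {v w : L2[d]} {ε : ℝ}
    (h : mob φ v w < ε) :
    ∃ q, ‖w - tau q v‖ < ε ∧ ‖q‖ * min ‖v‖ ‖w‖ < ε := by
  have hε : 0 < ε := (Real.sqrt_nonneg _).trans_lt h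
  have key : ∀ (x : ℝ) (q : EuclideanSpace ℝ (Fin d)) (u : L2[d]), 0 ≤ x →
      min ‖v‖ ‖w‖ ≤ ‖u‖ → x ^ 2 + ‖q‖ ^ 2 * φ ‖u‖ ^ 2 < ε ^ 2 →
      x < ε ∧ ‖q‖ * min ‖v‖ ‖w‖ < ε := by
    intro x q u hx hu hlt
    constructor
    · refine lt_of_pow_lt_pow_left₀ 2 hε.le ?_
      nlinarith [mul_nonneg (sq_nonneg ‖q‖) (sq_nonneg (φ ‖u‖))]
    · refine lt_of_le_of_lt (mul_le_mul_of_nonneg_left (hu.trans (hφ _ (norm_nonneg u)))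
        (norm_nonneg q)) (lt_of_pow_lt_pow_left₀ 2 hε.le ?_)
      nlinarith [sq_nonneg x]
  obtain ⟨r, ⟨q, rfl | rfl⟩, hr⟩ := exists_lt_of_csInf_lt
    (by exact ⟨_, 0, Or.inl rfl⟩) ((Real.sqrt_lt' hε).1 h)
  · exact ⟨q, key _ q v (norm_nonneg _) (min_le_left _ _) hr⟩
  · refine ⟨-q, ?_⟩
    rw [← norm_sub_tau_comm, norm_neg]
    exact key _ q w (norm_nonneg _) (min_le_right _ _) hr

end MobileDistance

/-- A sequence that is Cauchy up to arbitrarily small translations converges in `L²`. -/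
lemma exists_tendsto_of_cauchy_up_to_translation {d : ℕ} {v : ℕ → L2[d]}
    (h : ∀ ε > 0, ∃ N, ∀ m ≥ N, ∀ n ≥ N, ∃ q, ‖v n - tau q (v m)‖ < ε ∧ ‖q‖ < ε) :
    ∃ w, Tendsto v atTop (nhds w) := by
  obtain ⟨s, hs, hsv⟩ : ∃ s : ℕ → ℕ, StrictMono s ∧ ∀ k, ∀ m ≥ s k, ∀ n ≥ s k,
      ∃ q, ‖v n - tau q (v m)‖ < (1 / 2 : ℝ) ^ k ∧ ‖q‖ < (1 / 2 : ℝ) ^ k := by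
    refine extraction_forall_of_eventually' (P := fun k N => ∀ m ≥ N, ∀ n ≥ N,
      ∃ q, ‖v n - tau q (v m)‖ < (1 / 2 : ℝ) ^ k ∧ ‖q‖ < (1 / 2 : ℝ) ^ k) fun k => ?_
    obtain ⟨N, hN⟩ := h ((1 / 2 : ℝ) ^ k) (by positivity)
    exact ⟨N, fun k hk m hm n hn => hN m (hk.trans hm) n (hk.trans hn)⟩
  choose q hqv hq using fun k => hsv k (s k) le_rfl (s (k + 1)) (hs.monotone k.le_succ)
  let Q : ℕ → EuclideanSpace ℝ (Fin d) := fun k => ∑ j ∈ Finset.range k, q j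
  have hQsucc : ∀ k, Q (k + 1) = Q k + q k := fun k => Finset.sum_range_succ q k
  let u : ℕ → L2[d] := fun k => tau (-Q k) (v (s k))
  have hQ : CauchySeq Q := by
    refine cauchySeq_of_le_geometric (1 / 2) 1 (by norm_num) fun k => ?_
    rw [dist_eq_norm, hQsucc, sub_add_cancel_left, norm_neg, one_mul]
    exact (hq k).le
  have hu : CauchySeq u := by
    refine cauchySeq_of_le_geometric (1 / 2) 1 (by norm_num) fun k => ?_
    have : u k = tau (-Q (k + 1)) (tau (q k) (v (s k))) := by
      rw [tau_tau, hQsucc, neg_add_rev, add_neg_cancel_left]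
    rw [dist_eq_norm, norm_sub_rev, this, ← tau_sub, norm_tau, one_mul]
    exact (hqv k).le
  obtain ⟨Qlim, hQlim⟩ := cauchySeq_tendsto_of_complete hQ
  obtain ⟨ulim, hulim⟩ := cauchySeq_tendsto_of_complete hu
  have hvs : Tendsto (v ∘ s) atTop (nhds (tau Qlim ulim)) := by
    refine ((continuous_tau_s5.tendsto (Qlim, ulim)).comp (hQlim.prodMk_nhds hulim)).congr fun k => ?_
    simp [u, tau_tau, tau_zero]
  refine ⟨tau Qlim ulim, Metric.tendsto_atTop.2 fun ε hε => ?_⟩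
  obtain ⟨δ, hδ, hδw⟩ := Metric.continuousAt_iff.1
    (continuous_tau_s5.continuousAt (x := ((0 : EuclideanSpace ℝ (Fin d)), tau Qlim ulim)))
    (ε / 2) (half_pos hε)
  obtain ⟨N, hN⟩ := h (min (ε / 2) δ) (by positivity)
  obtain ⟨K, hK⟩ := Metric.tendsto_atTop.1 hvs δ hδ
  refine ⟨N, fun n hn => ?_⟩
  have hsk : N ≤ s (max N K) := (le_max_left N K).trans (hs.id_le _)
  obtain ⟨p, hp, hpδ⟩ := hN _ hsk n hn
  have h1 : dist (v n) (tau p (v (s (max N K)))) < ε / 2 := by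
    rw [dist_eq_norm]
    exact hp.trans_le (min_le_left _ _)
  have h2 : dist (tau p (v (s (max N K)))) (tau Qlim ulim) < ε / 2 := by
    have := @hδw (p, v (s (max N K))) (max_lt (by
      simpa using hpδ.trans_le (min_le_right _ _)) (hK _ (le_max_right N K)))
    simpa only [tau_zero] using this
  linarith [dist_triangle (v n) (tau p (v (s (max N K)))) (tau Qlim ulim)]

/-- **Completeness of the mobile distance**: if `(v^n)` is Cauchy for `m_φ`, then it
converges strongly in `L²` to some `v`; in particular it also converges to `v` in the
mobile distance. -/
theorem mob_complete {d : ℕ} (hd : 0 < d) (φ : ℝ → ℝ)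
    (hφc : ContinuousOn φ (Set.Ici 0)) (hφm : MonotoneOn φ (Set.Ici 0))
    (hφ1 : ∀ a : ℝ, 0 ≤ a → a ≤ φ a)
    (hφ4 : ∀ a b : ℝ, 0 ≤ a → 0 ≤ b → b ≤ 2 * a → φ b ≤ 4 * φ a)
    (v : ℕ → Lp ℝ 2 (volume : Measure (EuclideanSpace ℝ (Fin d))))
    (hcauchy : Tendsto (fun p : ℕ × ℕ => mob φ (v p.1) (v p.2)) atTop (nhds 0)) :
    ∃ w : Lp ℝ 2 (volume : Measure (EuclideanSpace ℝ (Fin d))),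
      Tendsto (fun n => ‖v n - w‖) atTop (nhds 0) ∧
      Tendsto (fun n => mob φ (v n) w) atTop (nhds 0) := by
  obtain ⟨w, hw⟩ : ∃ w, Tendsto v atTop (nhds w) := by
    have hmob : ∀ ε > 0, ∃ N, ∀ m ≥ N, ∀ n ≥ N,
        ∃ q, ‖v n - tau q (v m)‖ < ε ∧ ‖q‖ * min ‖v m‖ ‖v n‖ < ε := by
      intro ε hε
      obtain ⟨⟨M, N⟩, hMN⟩ := eventually_atTop.1 (hcauchy.eventually_lt_const hε)
      exact ⟨max M N, fun m hm n hn => exists_norm_sub_tau_lt_of_mob_lt hφ1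
        (hMN (m, n) ⟨(le_max_left _ _).trans hm, (le_max_right _ _).trans hn⟩)⟩
    by_cases hc : ∃ c > 0, ∃ N, ∀ n ≥ N, c ≤ ‖v n‖
    · obtain ⟨c, hc, N₀, hN₀⟩ := hc
      refine exists_tendsto_of_cauchy_up_to_translation fun ε hε => ?_
      obtain ⟨N, hN⟩ := hmob (min ε (ε * c)) (by positivity)
      refine ⟨max N₀ N, fun m hm n hn => ?_⟩
      obtain ⟨q, hq, hqc⟩ := hN m ((le_max_right _ _).trans hm) n ((le_max_right _ _).trans hn)
      refine ⟨q, hq.trans_le (min_le_left _ _), lt_of_mul_lt_mul_right ?_ hc.le⟩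
      calc ‖q‖ * c ≤ ‖q‖ * min ‖v m‖ ‖v n‖ := by
            gcongr
            exact le_min (hN₀ m ((le_max_left _ _).trans hm)) (hN₀ n ((le_max_left _ _).trans hn))
        _ < ε * c := hqc.trans_le (min_le_right _ _)
    · push Not at hc
      refine ⟨0, Metric.tendsto_atTop.2 fun ε hε => ?_⟩
      obtain ⟨N, hN⟩ := hmob (ε / 2) (half_pos hε)
      obtain ⟨m, hm, hmε⟩ := hc (ε / 2) (half_pos hε) N
      refine ⟨N, fun n hn => ?_⟩
      obtain ⟨q, hq, -⟩ := hN m hm n hn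
      rw [dist_zero_right]
      linarith [norm_le_norm_sub_add (v n) (tau q (v m)), norm_tau q (v m)]
  have hw' : Tendsto (fun n => ‖v n - w‖) atTop (nhds 0) := tendsto_iff_norm_sub_tendsto_zero.1 hw
  exact ⟨w, hw', squeeze_zero (fun _ => Real.sqrt_nonneg _) (fun n => mob_le_norm_sub (v n) w) hw'⟩
end
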